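/- Let F, G be smooth vector fields on ℝ³ with ∇·F = 0 and G vanishing at large |x|. Define the commutator [Δ_q, F × ∇×]G = Δ_q(F × (∇ × G)) − F × (∇ × G_q), where Δ_q is the Littlewood–Paley projection and G_q = Δ_q G. Then for 1 ≤ r ≤ ∞, ‖[Δ_q, F × ∇×]G‖_{L^r} ≤ C ‖∇F‖_{L^∞} ‖G‖_{L^r} with C independent of q, F, G. -/

import Mathlib

open MeasureTheory
open scoped ENNReal

noncomputable section

abbrev E3 : Type := EuclideanSpace ℝ (Fin 3)

/-- Partial derivative in direction `i`. -/
def pd (f : E3 → ℝ) (i : Fin 3) : E3 → ℝ :=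
  fun x => fderiv ℝ f x (EuclideanSpace.single i 1)

/-- Cross product of vectors in `ℝ³`. -/
def cross (a b : Fin 3 → ℝ) : Fin 3 → ℝ :=
  ![a 1 * b 2 - a 2 * b 1, a 2 * b 0 - a 0 * b 2, a 0 * b 1 - a 1 * b 0]

/-- Curl of a vector field on `ℝ³`. -/
def curl (b : E3 → Fin 3 → ℝ) : E3 → Fin 3 → ℝ :=
  fun x => ![pd (fun y => b y 2) 1 x - pd (fun y => b y 1) 2 x,
             pd (fun y => b y 0) 2 x - pd (fun y => b y 2) 0 x,
             pd (fun y => b y 1) 0 x - pd (fun y => b y 0) 1 x]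

/-- The Littlewood–Paley projection `Δ_q`, given as convolution with `2^{3q} h(2^q ·)`,
applied componentwise to a vector field. -/
def lpConv (h : SchwartzMap E3 ℝ) (q : ℤ) (G : E3 → Fin 3 → ℝ) : E3 → Fin 3 → ℝ :=
  fun x i => (2 : ℝ) ^ (3 * q) * ∫ y : E3, h ((2 : ℝ) ^ q • (x - y)) * G y i

/-- Young's inequality `L¹ * Lʳ → Lʳ` for nonnegative functions. -/
lemma young_lintegral (K g : E3 → ℝ≥0∞) (hK : Measurable K) (hg : Measurable g)
    (r : ℝ≥0∞) (hr : 1 ≤ r) :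
    eLpNorm (fun x : E3 => ∫⁻ y, K (x - y) * g y) r volume
      ≤ (∫⁻ z, K z) * eLpNorm g r volume := by
  have hr0 : r ≠ 0 := (lt_of_lt_of_le zero_lt_one hr).ne'
  by_cases hrt : r = ⊤
  · subst hrt
    rw [eLpNorm_exponent_top, eLpNorm_exponent_top]
    apply eLpNormEssSup_le_of_ae_enorm_bound
    refine Filter.Eventually.of_forall fun x => ?_
    rw [enorm_eq_self]
    calc ∫⁻ y, K (x - y) * g y ≤ ∫⁻ y, K (x - y) * eLpNormEssSup g volume := by
          apply lintegral_mono_ae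
          filter_upwards [ae_le_eLpNormEssSup (f := g) (μ := (volume : Measure E3))] with y hy
          rw [enorm_eq_self] at hy
          gcongr
      _ = _ := by
          rw [lintegral_mul_const _ (by fun_prop), lintegral_sub_left_eq_self (fun z => K z) x]
  · have hp1 : 1 ≤ r.toReal := by
      rw [← ENNReal.toReal_one]; exact ENNReal.toReal_mono hrt hr
    have hp0 : 0 < r.toReal := by linarith
    rw [eLpNorm_eq_lintegral_rpow_enorm_toReal hr0 hrt,
      eLpNorm_eq_lintegral_rpow_enorm_toReal hr0 hrt]
    set p := r.toReal with hp
    simp only [enorm_eq_self]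
    have key : ∀ x : E3, (∫⁻ y, K (x - y) * g y) ^ p
        ≤ (∫⁻ y, K y * g (x - y) ^ p) * (∫⁻ z, K z) ^ (p - 1) := by
      intro x
      have h1 : ∫⁻ y, K (x - y) * g y = ∫⁻ y, K y * g (x - y) := by
        rw [← lintegral_sub_left_eq_self (fun y => K y * g (x - y)) x]
        simp
      have h2 := eLpNorm'_le_eLpNorm'_mul_rpow_measure_univ (p := 1) (q := p)
        (μ := (volume : Measure E3).withDensity K) (f := fun y => g (x - y)) one_pos hp1
        (by exact (hg.comp (by fun_prop)).aestronglyMeasurable)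
      simp only [eLpNorm'_eq_lintegral_enorm, enorm_eq_self, ENNReal.rpow_one, div_one] at h2
      rw [lintegral_withDensity_eq_lintegral_mul _ hK (by fun_prop),
        lintegral_withDensity_eq_lintegral_mul _ hK (by fun_prop),
        withDensity_apply _ MeasurableSet.univ] at h2
      simp only [Pi.mul_apply, Measure.restrict_univ] at h2
      rw [h1]
      refine (ENNReal.rpow_le_rpow h2 hp0.le).trans (le_of_eq ?_)
      rw [ENNReal.mul_rpow_of_nonneg _ _ hp0.le, ← ENNReal.rpow_mul, ← ENNReal.rpow_mul]
      congr 2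
      · rw [one_div, inv_mul_cancel₀ hp0.ne', ENNReal.rpow_one]
      · field_simp
    have key2 : ∫⁻ x, (∫⁻ y, K (x - y) * g y) ^ p
        ≤ (∫⁻ z, K z) ^ p * ∫⁻ y, g y ^ p := by
      calc ∫⁻ x, (∫⁻ y, K (x - y) * g y) ^ p
          ≤ ∫⁻ x, (∫⁻ y, K y * g (x - y) ^ p) * (∫⁻ z, K z) ^ (p - 1) := lintegral_mono key
        _ = (∫⁻ x, ∫⁻ y, K y * g (x - y) ^ p) * (∫⁻ z, K z) ^ (p - 1) := by
            rw [lintegral_mul_const]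
            exact Measurable.lintegral_prod_right' (f := fun z : E3 × E3 => K z.2 * g (z.1 - z.2) ^ p)
              (by fun_prop)
        _ = (∫⁻ y, ∫⁻ x, K y * g (x - y) ^ p) * (∫⁻ z, K z) ^ (p - 1) := by
            rw [lintegral_lintegral_swap]
            apply Measurable.aemeasurable
            simp only [Function.uncurry_def]
            fun_prop
        _ = (∫⁻ y, K y * ∫⁻ x, g x ^ p) * (∫⁻ z, K z) ^ (p - 1) := by
            congr 2
            ext y
            rw [lintegral_const_mul _ (by fun_prop),
              lintegral_sub_right_eq_self (fun x => g x ^ p) y]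
        _ = _ := by
            rw [lintegral_mul_const _ hK, mul_right_comm]
            congr 1
            nth_rewrite 1 [← ENNReal.rpow_one (∫⁻ z, K z)]
            rw [← ENNReal.rpow_add_of_nonneg _ _ zero_le_one (by linarith)]
            congr 1; ring
    refine (ENNReal.rpow_le_rpow key2 (by positivity)).trans (le_of_eq ?_)
    rw [ENNReal.mul_rpow_of_nonneg _ _ (by positivity), ← ENNReal.rpow_mul]
    rw [mul_one_div_cancel hp0.ne', ENNReal.rpow_one]

lemma fderiv_conv (k g : E3 → ℝ) (hk : Continuous k) (hg : ContDiff ℝ 1 g)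
    (hc : HasCompactSupport g) (x v : E3) :
    fderiv ℝ (fun x => ∫ y, k (x - y) * g y) x v = ∫ y, k (x - y) * fderiv ℝ g y v := by
  have h1 := hc.hasFDerivAt_convolution_right (ContinuousLinearMap.mul ℝ ℝ)
    (hk.locallyIntegrable (μ := volume)) hg x
  have h2 : (convolution k g (ContinuousLinearMap.mul ℝ ℝ) volume)
      = fun x => ∫ y, k (x - y) * g y := by
    ext x; exact convolution_mul_swap
  rw [h2] at h1
  rw [h1.fderiv, convolution_precompR_apply _ (hk.locallyIntegrable (μ := volume))
    (hc.fderiv (𝕜 := ℝ)) (hg.continuous_fderiv (by simp)), convolution_mul_swap]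

lemma term_bound (k f g : E3 → ℝ) (hk : ContDiff ℝ 1 k) (hf : ContDiff ℝ 1 f)
    (hg : ContDiff ℝ 1 g) (hc : HasCompactSupport g) (L : ℝ)
    (hL : ∀ x, ‖fderiv ℝ f x‖ ≤ L) (x v : E3) (hv : ‖v‖ ≤ 1) :
    ‖∫ y, k (x - y) * ((f y - f x) * fderiv ℝ g y v)‖ₑ
      ≤ ENNReal.ofReal L * ∫⁻ y, ENNReal.ofReal
        (‖x - y‖ * ‖fderiv ℝ k (x - y)‖ + ‖k (x - y)‖) * ‖g y‖ₑ := by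
  have hL0 : 0 ≤ L := (norm_nonneg _).trans (hL 0)
  have hd : Differentiable ℝ f := hf.differentiable (by simp)
  have hkd : Differentiable ℝ k := hk.differentiable (by simp)
  set w : E3 → ℝ := fun y => k (x - y) * (f y - f x) with hw
  have hwc : ContDiff ℝ 1 w := by
    rw [hw]; fun_prop
  have hgc := hg.continuous
  have hfg := hg.continuous_fderiv (by simp)
  have hfw := hwc.continuous_fderiv (by simp)
  have hwc' := hwc.continuous
  have hw' : ∀ y, fderiv ℝ w y v
      = k (x - y) * fderiv ℝ f y v - (f y - f x) * fderiv ℝ k (x - y) v := by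
    intro y
    have e1 : HasFDerivAt (fun y => k (x - y)) (-(fderiv ℝ k (x - y))) y := by
      have := (hkd (x - y)).hasFDerivAt.comp y ((hasFDerivAt_id y).const_sub x)
      have e : -(fderiv ℝ k (x - y)) = (fderiv ℝ k (x - y)).comp (-ContinuousLinearMap.id ℝ E3) := by
        ext u; simp
      rw [e]
      exact this
    have e2 : HasFDerivAt (fun y => f y - f x) (fderiv ℝ f y) y :=
      (hd y).hasFDerivAt.sub_const _
    have e3 : HasFDerivAt w _ y := e1.mul e2
    rw [e3.fderiv]
    simp
    ring
  have ibp : ∫ y, k (x - y) * ((f y - f x) * fderiv ℝ g y v)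
      = - ∫ y, fderiv ℝ w y v * g y := by
    rw [← integral_mul_fderiv_eq_neg_fderiv_mul_of_integrable]
    · simp only [hw, mul_assoc]
    · exact Continuous.integrable_of_hasCompactSupport (by fun_prop) hc.mul_left
    · exact Continuous.integrable_of_hasCompactSupport (by fun_prop)
        (hc.fderiv_apply (𝕜 := ℝ) v).mul_left
    · exact Continuous.integrable_of_hasCompactSupport (by fun_prop) hc.mul_left
    · exact fun y _ => hwc.differentiable (by simp) y
    · exact fun y _ => hg.differentiable (by simp) y
  rw [ibp, enorm_neg]
  refine (enorm_integral_le_lintegral_enorm _).trans ?_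
  rw [← lintegral_const_mul' _ _ ENNReal.ofReal_ne_top]
  refine lintegral_mono fun y => ?_
  dsimp only
  rw [enorm_mul, ← mul_assoc, ← ENNReal.ofReal_mul hL0]
  gcongr
  rw [← ofReal_norm]
  apply ENNReal.ofReal_le_ofReal
  rw [hw']
  have b1 : ‖fderiv ℝ f y v‖ ≤ L :=
    ((fderiv ℝ f y).le_of_opNorm_le (hL y) v).trans (mul_le_of_le_one_right hL0 hv)
  have b2 : ‖fderiv ℝ k (x - y) v‖ ≤ ‖fderiv ℝ k (x - y)‖ :=
    ((fderiv ℝ k (x - y)).le_opNorm v).trans (mul_le_of_le_one_right (norm_nonneg _) hv)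
  have b3 : ‖f y - f x‖ ≤ L * ‖x - y‖ := by
    rw [norm_sub_rev x y]
    exact convex_univ.norm_image_sub_le_of_norm_fderiv_le (𝕜 := ℝ)
      (fun z _ => hd z) (fun z _ => hL z) (Set.mem_univ _) (Set.mem_univ _)
  calc _ ≤ ‖k (x - y) * fderiv ℝ f y v‖ + ‖(f y - f x) * fderiv ℝ k (x - y) v‖ :=
        norm_sub_le _ _
    _ ≤ ‖k (x - y)‖ * L + (L * ‖x - y‖) * ‖fderiv ℝ k (x - y)‖ := by
        rw [norm_mul, norm_mul]; gcongr
    _ = _ := by ring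

/-- The scaled kernel. -/
def ker (h : SchwartzMap E3 ℝ) (q : ℤ) : E3 → ℝ := fun z => (2 : ℝ) ^ (3 * q) * h ((2 : ℝ) ^ q • z)

lemma ker_contDiff (h : SchwartzMap E3 ℝ) (q : ℤ) : ContDiff ℝ 1 (ker h q) := by
  unfold ker
  have := h.smooth 1
  fun_prop

lemma lintegral_ker (h : SchwartzMap E3 ℝ) (q : ℤ) :
    ∫⁻ z, ENNReal.ofReal (‖z‖ * ‖fderiv ℝ (ker h q) z‖ + ‖ker h q z‖)
      = ENNReal.ofReal (∫ z, (‖z‖ * ‖fderiv ℝ h z‖ + ‖h z‖)) := by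
  set c : ℝ := (2 : ℝ) ^ q with hc
  have hc0 : 0 < c := by positivity
  have hc3 : (2 : ℝ) ^ (3 * q) = c ^ 3 := by
    rw [hc, mul_comm, zpow_mul]; norm_cast
  have hint : Integrable (fun z => ‖z‖ * ‖fderiv ℝ h z‖ + ‖h z‖) volume := by
    apply Integrable.add
    · have := h.integrable_pow_mul_iteratedFDeriv volume 1 1
      simpa [norm_iteratedFDeriv_one] using this
    · exact (h.integrable).norm
  have e : ∀ z, ‖z‖ * ‖fderiv ℝ (ker h q) z‖ + ‖ker h q z‖
      = c ^ 3 * ((fun z => ‖z‖ * ‖fderiv ℝ h z‖ + ‖h z‖) (c • z)) := by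
    intro z
    have hd : fderiv ℝ (ker h q) z = c ^ 3 • c • fderiv ℝ h (c • z) := by
      unfold ker
      rw [← fderiv_comp_smul, hc3]
      exact fderiv_const_mul (by have := h.differentiable; fun_prop) _
    rw [hd]
    simp only [ker, hc3, norm_smul, norm_mul, norm_pow, Real.norm_of_nonneg hc0.le, ← hc]
    ring
  rw [lintegral_congr fun z => congrArg ENNReal.ofReal (e z)]
  rw [← ofReal_integral_eq_lintegral_ofReal]
  · rw [integral_const_mul, Measure.integral_comp_smul volume (fun z => ‖z‖ * ‖fderiv ℝ h z‖ + ‖h z‖) c]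
    congr 1
    rw [abs_of_nonneg (by positivity)]
    simp only [finrank_euclideanSpace, Fintype.card_fin, smul_eq_mul]
    field_simp
  · exact (hint.comp_smul hc0.ne').const_mul _
  · exact Filter.Eventually.of_forall fun z => by positivity

lemma enorm_pi_le (v : Fin 3 → ℝ) (B : ℝ≥0∞) (hv : ∀ i, ‖v i‖ₑ ≤ B) : ‖v‖ₑ ≤ B := by
  induction B with
  | top => exact le_top
  | coe B =>
    rw [enorm_le_coe]
    exact (pi_nnnorm_le_iff).2 fun i => enorm_le_coe.1 (hv i)

lemma lpConv_eq (h : SchwartzMap E3 ℝ) (q : ℤ) (G : E3 → Fin 3 → ℝ) (x : E3) (i : Fin 3) :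
    lpConv h q G x i = ∫ y, ker h q (x - y) * G y i := by
  simp only [lpConv, ker, mul_assoc, integral_const_mul]

/-- The elementary scalar commutator term. -/
def cterm (h : SchwartzMap E3 ℝ) (q : ℤ) (F G : E3 → Fin 3 → ℝ) (a j b : Fin 3) (x : E3) : ℝ :=
  ∫ y, ker h q (x - y) * ((F y a - F x a) * pd (fun y => G y b) j y)

lemma comp_contDiff {G : E3 → Fin 3 → ℝ} (hG : ContDiff ℝ (⊤ : ℕ∞) G) (b : Fin 3) :
    ContDiff ℝ 1 (fun y => G y b) :=
  (contDiff_pi.1 hG b).of_le (by exact_mod_cast le_top)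

lemma comp_hcs {G : E3 → Fin 3 → ℝ} (hG : HasCompactSupport G) (b : Fin 3) :
    HasCompactSupport (fun y => G y b) :=
  hG.comp_left (g := fun v : Fin 3 → ℝ => v b) rfl

lemma pd_cont {G : E3 → Fin 3 → ℝ} (hG : ContDiff ℝ (⊤ : ℕ∞) G) (b j : Fin 3) :
    Continuous (pd (fun y => G y b) j) := by
  have := (comp_contDiff hG b).continuous_fderiv (by simp)
  unfold pd
  fun_prop

lemma pint (h : SchwartzMap E3 ℝ) (q : ℤ) {F G : E3 → Fin 3 → ℝ}
    (hF : ContDiff ℝ (⊤ : ℕ∞) F) (hG : ContDiff ℝ (⊤ : ℕ∞) G) (hc : HasCompactSupport G)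
    (a j b : Fin 3) (x : E3) :
    Integrable (fun y => ker h q (x - y) * (F y a * pd (fun y => G y b) j y)) volume := by
  have h1 := (ker_contDiff h q).continuous
  have h2 := (comp_contDiff hF a).continuous
  have h3 := pd_cont hG b j
  exact Continuous.integrable_of_hasCompactSupport (by fun_prop)
    (((comp_hcs hc b).fderiv_apply (𝕜 := ℝ) _).mul_left.mul_left)

lemma cterm_eq (h : SchwartzMap E3 ℝ) (q : ℤ) {F G : E3 → Fin 3 → ℝ}
    (hF : ContDiff ℝ (⊤ : ℕ∞) F) (hG : ContDiff ℝ (⊤ : ℕ∞) G) (hc : HasCompactSupport G)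
    (a j b : Fin 3) (x : E3) :
    cterm h q F G a j b x = (∫ y, ker h q (x - y) * (F y a * pd (fun y => G y b) j y))
      - F x a * pd (fun y => lpConv h q G y b) j x := by
  have e : pd (fun y => lpConv h q G y b) j x
      = ∫ y, ker h q (x - y) * pd (fun y => G y b) j y := by
    simp only [lpConv_eq]
    exact fderiv_conv _ _ (ker_contDiff h q).continuous (comp_contDiff hG b) (comp_hcs hc b) x _
  rw [e, ← integral_const_mul, ← integral_sub (pint h q hF hG hc a j b x)]
  · unfold cterm
    congr 1; ext y; ring
  · have := (pint h q (F := fun _ => F x) contDiff_const hG hc a j b x)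
    refine this.congr (Filter.Eventually.of_forall fun y => ?_)
    dsimp only; ring

lemma comm_comp (h : SchwartzMap E3 ℝ) (q : ℤ) {F G : E3 → Fin 3 → ℝ}
    (hF : ContDiff ℝ (⊤ : ℕ∞) F) (hG : ContDiff ℝ (⊤ : ℕ∞) G) (hc : HasCompactSupport G)
    (x : E3) (i : Fin 3) : ∃ a₁ j₁ b₁ a₂ j₂ b₂ a₃ j₃ b₃ a₄ j₄ b₄ : Fin 3,
    (lpConv h q (fun y => cross (F y) (curl G y)) x - cross (F x) (curl (lpConv h q G) x)) i
      = (cterm h q F G a₁ j₁ b₁ x - cterm h q F G a₂ j₂ b₂ x)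
        - (cterm h q F G a₃ j₃ b₃ x - cterm h q F G a₄ j₄ b₄ x) := by
  have split : ∀ a₁ j₁ b₁ a₂ j₂ b₂ a₃ j₃ b₃ a₄ j₄ b₄ : Fin 3,
      ∫ y, ker h q (x - y) *
        ((F y a₁ * pd (fun y => G y b₁) j₁ y - F y a₂ * pd (fun y => G y b₂) j₂ y)
        - (F y a₃ * pd (fun y => G y b₃) j₃ y - F y a₄ * pd (fun y => G y b₄) j₄ y))
      = ((∫ y, ker h q (x - y) * (F y a₁ * pd (fun y => G y b₁) j₁ y))
        - ∫ y, ker h q (x - y) * (F y a₂ * pd (fun y => G y b₂) j₂ y))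
        - ((∫ y, ker h q (x - y) * (F y a₃ * pd (fun y => G y b₃) j₃ y))
        - ∫ y, ker h q (x - y) * (F y a₄ * pd (fun y => G y b₄) j₄ y)) := by
    intro a₁ j₁ b₁ a₂ j₂ b₂ a₃ j₃ b₃ a₄ j₄ b₄
    have P := fun a j b => pint h q hF hG hc a j b x
    rw [← integral_sub (P _ _ _) (P _ _ _), ← integral_sub (P _ _ _) (P _ _ _)]
    refine Eq.trans ?_ (integral_sub ((P _ _ _).sub (P _ _ _)) ((P _ _ _).sub (P _ _ _)))
    congr 1; ext y; ring
  rw [Pi.sub_apply, lpConv_eq]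
  fin_cases i
  · refine ⟨1, 0, 1, 1, 1, 0, 2, 2, 0, 2, 0, 2, ?_⟩
    simp only [cterm_eq h q hF hG hc]
    have := split 1 0 1 1 1 0 2 2 0 2 0 2
    simp only [cross, curl, Fin.zero_eta, Matrix.cons_val_zero, Matrix.cons_val_one,
      Matrix.cons_val, mul_sub] at this ⊢
    rw [this]; ring
  · refine ⟨2, 1, 2, 2, 2, 1, 0, 0, 1, 0, 1, 0, ?_⟩
    simp only [cterm_eq h q hF hG hc]
    have := split 2 1 2 2 2 1 0 0 1 0 1 0
    simp only [cross, curl, Fin.mk_one, Matrix.cons_val_zero, Matrix.cons_val_one,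
      Matrix.cons_val, mul_sub] at this ⊢
    rw [this]; ring
  · refine ⟨0, 2, 0, 0, 0, 2, 1, 1, 2, 1, 2, 1, ?_⟩
    simp only [cterm_eq h q hF hG hc]
    have := split 0 2 0 0 0 2 1 1 2 1 2 1
    simp only [cross, curl, Fin.reduceFinMk, Matrix.cons_val_zero, Matrix.cons_val_one,
      Matrix.cons_val, mul_sub] at this ⊢
    rw [this]; ring

/-- The dominating kernel. -/
def domKer (h : SchwartzMap E3 ℝ) (q : ℤ) : E3 → ℝ≥0∞ :=
  fun z => ENNReal.ofReal (‖z‖ * ‖fderiv ℝ (ker h q) z‖ + ‖ker h q z‖)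

lemma comm_pointwise (h : SchwartzMap E3 ℝ) (q : ℤ) {F G : E3 → Fin 3 → ℝ}
    (hF : ContDiff ℝ (⊤ : ℕ∞) F) (hG : ContDiff ℝ (⊤ : ℕ∞) G) (hc : HasCompactSupport G)
    (L : ℝ) (hL : ∀ x, ‖fderiv ℝ F x‖ ≤ L) (x : E3) :
    ‖lpConv h q (fun y => cross (F y) (curl G y)) x - cross (F x) (curl (lpConv h q G) x)‖ₑ
      ≤ ENNReal.ofReal (4 * L) * ∫⁻ y, domKer h q (x - y) * ‖G y‖ₑ := by
  have hL0 : 0 ≤ L := (norm_nonneg _).trans (hL 0)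
  set M := ENNReal.ofReal L * ∫⁻ y, domKer h q (x - y) * ‖G y‖ₑ with hM
  have hT : ∀ a j b, ‖cterm h q F G a j b x‖ₑ ≤ M := by
    intro a j b
    refine (term_bound (ker h q) (fun y => F y a) (fun y => G y b) (ker_contDiff h q)
      (comp_contDiff hF a) (comp_contDiff hG b) (comp_hcs hc b) L ?_ x
      (EuclideanSpace.single j 1) (by simp)).trans ?_
    · intro z
      have hd : DifferentiableAt ℝ F z := hF.differentiable (by simp) z
      refine le_trans ?_ (hL z)
      refine ContinuousLinearMap.opNorm_le_bound _ (norm_nonneg _) fun u => ?_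
      have : fderiv ℝ (fun y => F y a) z u = fderiv ℝ F z u a := by
        rw [((hasFDerivAt_pi'.1 hd.hasFDerivAt) a).fderiv]; rfl
      rw [this]
      exact (norm_le_pi_norm _ a).trans ((fderiv ℝ F z).le_opNorm u)
    · rw [hM]
      gcongr with y
      · exact le_rfl
      · rw [← ofReal_norm, ← ofReal_norm]
        exact ENNReal.ofReal_le_ofReal (norm_le_pi_norm (G y) b)
  have e4 : ENNReal.ofReal (4 * L) * ∫⁻ y, domKer h q (x - y) * ‖G y‖ₑ = (M + M) + (M + M) := by
    rw [hM, ENNReal.ofReal_mul (by norm_num), ENNReal.ofReal_ofNat]; ring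
  rw [e4]
  refine enorm_pi_le _ _ fun i => ?_
  obtain ⟨a₁, j₁, b₁, a₂, j₂, b₂, a₃, j₃, b₃, a₄, j₄, b₄, e⟩ := comm_comp h q hF hG hc x i
  rw [e]
  refine (enorm_sub_le).trans ?_
  gcongr
  · exact (enorm_sub_le).trans (add_le_add (hT _ _ _) (hT _ _ _))
  · exact (enorm_sub_le).trans (add_le_add (hT _ _ _) (hT _ _ _))

/-- **Commutator estimate for the Hall term**: with
`[Δ_q, F × ∇×]G = Δ_q(F × (∇ × G)) − F × (∇ × G_q)`, for divergence-free `F` and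
decaying `G` one has `‖[Δ_q, F × ∇×]G‖_{L^r} ≤ C ‖∇F‖_{L^∞} ‖G‖_{L^r}`, with `C`
independent of `q`, `F`, `G`. -/
theorem hall_commutator_estimate (h : SchwartzMap E3 ℝ) (r : ℝ≥0∞) (hr : 1 ≤ r) :
    ∃ C : ℝ, 0 < C ∧
      ∀ (q : ℤ) (F G : E3 → Fin 3 → ℝ),
        ContDiff ℝ (⊤ : ℕ∞) F → ContDiff ℝ (⊤ : ℕ∞) G → HasCompactSupport G →
        (∀ x : E3, ∑ i : Fin 3, pd (fun y => F y i) i x = 0) →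
        eLpNorm (fun x : E3 =>
            lpConv h q (fun y => cross (F y) (curl G y)) x
              - cross (F x) (curl (lpConv h q G) x)) r volume ≤
          ENNReal.ofReal C * eLpNorm (fun x : E3 => fderiv ℝ F x) ⊤ volume *
            eLpNorm G r volume := by
  set A : ℝ := ∫ z, (‖z‖ * ‖fderiv ℝ h z‖ + ‖h z‖) with hA
  have hA0 : 0 ≤ A := integral_nonneg fun z => by positivity
  refine ⟨4 * A + 1, by linarith, ?_⟩
  intro q F G hF hG hc _
  set N := eLpNorm (fun x : E3 => fderiv ℝ F x) ⊤ volume with hN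
  by_cases hNt : N = ⊤
  · by_cases hG0 : eLpNorm G r volume = 0
    · rw [eLpNorm_eq_zero_iff hG.continuous.aestronglyMeasurable
        (lt_of_lt_of_le zero_lt_one hr).ne',
        hG.continuous.ae_eq_iff_eq volume continuous_zero] at hG0
      have hz : (fun x : E3 => lpConv h q (fun y => cross (F y) (curl G y)) x
              - cross (F x) (curl (lpConv h q G) x)) = 0 := by
        subst hG0
        ext x i
        obtain ⟨a₁, j₁, b₁, a₂, j₂, b₂, a₃, j₃, b₃, a₄, j₄, b₄, e⟩ := comm_comp h q hF hG hc x i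
        rw [e]
        simp [cterm, pd]
      rw [hz]
      simp
    · rw [hNt, ENNReal.mul_top (by simp; linarith), ENNReal.top_mul hG0]
      exact le_top
  · have hL : ∀ x, ‖fderiv ℝ F x‖ ≤ N.toReal := by
      have hcf : Continuous (fun x => fderiv ℝ F x) := hF.continuous_fderiv (by simp)
      have hae : ∀ᵐ x : E3, ‖fderiv ℝ F x‖ ≤ N.toReal := by
        filter_upwards [ae_le_eLpNormEssSup (f := fun x => fderiv ℝ F x)
          (μ := (volume : Measure E3))] with x hx
        rw [← eLpNorm_exponent_top, ← hN] at hx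
        rw [← toReal_enorm]
        exact ENNReal.toReal_mono hNt hx
      have hd := Measure.dense_of_ae hae
      have hcl : IsClosed {x : E3 | ‖fderiv ℝ F x‖ ≤ N.toReal} :=
        isClosed_le hcf.norm continuous_const
      intro x
      have : x ∈ closure {x : E3 | ‖fderiv ℝ F x‖ ≤ N.toReal} := hd x
      rwa [hcl.closure_eq] at this
    have hKm : Measurable (domKer h q) := by
      have h1 := (ker_contDiff h q).continuous
      have h2 := (ker_contDiff h q).continuous_fderiv (by simp)
      unfold domKer
      exact ENNReal.measurable_ofReal.comp (Continuous.measurable (by fun_prop))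
    have hGm : Measurable (fun y => ‖G y‖ₑ) := hG.continuous.enorm.measurable
    set Φ : E3 → ℝ≥0∞ := fun x => ∫⁻ y, domKer h q (x - y) * ‖G y‖ₑ with hΦ
    have hY := young_lintegral (domKer h q) (fun y => ‖G y‖ₑ) hKm hGm r hr
    rw [eLpNorm_enorm] at hY
    have hI : ∫⁻ z, domKer h q z = ENNReal.ofReal A := lintegral_ker h q
    rw [hI] at hY
    have hs : eLpNorm (fun x : E3 => lpConv h q (fun y => cross (F y) (curl G y)) x
              - cross (F x) (curl (lpConv h q G) x)) r volume
        ≤ ENNReal.ofReal (4 * N.toReal) * eLpNorm Φ r volume :=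
      eLpNorm_le_nnreal_smul_eLpNorm_of_ae_le_mul' (c := (4 * N.toReal).toNNReal)
        (Filter.Eventually.of_forall fun x =>
          comm_pointwise h q hF hG hc N.toReal hL x) r
    calc _ ≤ ENNReal.ofReal (4 * N.toReal) * (ENNReal.ofReal A * eLpNorm G r volume) :=
          hs.trans (by gcongr)
      _ = ENNReal.ofReal (4 * A) * N * eLpNorm G r volume := by
          rw [ENNReal.ofReal_mul (by norm_num), ENNReal.ofReal_mul (by norm_num),
            ENNReal.ofReal_toReal hNt]
          ring
      _ ≤ _ := by
          gcongr
          linarith
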